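/- arXiv:2005.02685 — 2 statements merged into one kernel-verified Lean document; each statement's English description precedes it below -/
import Mathlib

section
/- For every integer m ≥ 0, ∑_{k=2}^∞ (ζ(k) − 1)·L_{k+m−1} = L_{m+1} + L_{m−1}·(π/√5)·tan(√5·π/2) + L_m·∑_{n=1}^∞ 1/(n(n² + n − 1)), where for m = 0 one sets L_{−1} = −1 (the standard extension L_{−n} = (−1)^n L_n). -/
open Real

def lucas : ℕ → ℕ
  | 0 => 2
  | 1 => 1
  | n + 2 => lucas n + lucas (n + 1)

def fibZ (n : ℤ) : ℤ :=
  if 0 ≤ n then (Nat.fib n.toNat : ℤ) else (-1) ^ (n.natAbs + 1) * (Nat.fib n.natAbs : ℤ)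

def lucasZ (n : ℤ) : ℤ :=
  if 0 ≤ n then (lucas n.toNat : ℤ) else (-1) ^ n.natAbs * (lucas n.natAbs : ℤ)

open scoped goldenRatio

theorem lucas_eq_goldenRatio_pow_add_goldenConj_pow (n : ℕ) : (lucas n : ℝ) = φ ^ n + ψ ^ n := by
  induction n using lucas.induct with
  | case1 => norm_num [lucas]
  | case2 => simp [lucas, goldenRatio_add_goldenConj]
  | case3 n ih₁ ih₂ =>
    rw [lucas, Nat.cast_add, ih₁, ih₂]
    rw [pow_add φ n 2, pow_add ψ n 2, goldenRatio_sq, goldenConj_sq, pow_succ, pow_succ]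
    generalize φ = p, ψ = q
    ring

theorem hasSum_lucas_mul_pow (m : ℕ) {x : ℝ} (hx₀ : 0 ≤ x) (hx : x ≤ 1 / 2) :
    HasSum (fun k : ℕ ↦ (lucas (k + m + 1) : ℝ) * x ^ (k + 2))
      (x ^ 2 * (lucas (m + 1) + lucas m * x) / (1 - x - x ^ 2)) := by
  have hφ : φ * x < 1 := by nlinarith [goldenRatio_lt_two, goldenRatio_pos]
  have hψ : |ψ * x| < 1 := by
    rw [abs_lt]
    constructor <;> nlinarith [neg_one_lt_goldenConj, goldenConj_neg]
  have h₁ := (hasSum_geometric_of_lt_one (mul_nonneg goldenRatio_pos.le hx₀) hφ).mul_left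
    (x ^ 2 * φ ^ (m + 1))
  have h₂ := (hasSum_geometric_of_abs_lt_one hψ).mul_left (x ^ 2 * ψ ^ (m + 1))
  convert! h₁.add h₂ using 1
  · ext k
    rw [lucas_eq_goldenRatio_pow_add_goldenConj_pow]
    generalize φ = p, ψ = q
    ring
  · have hφ' : 1 - φ * x ≠ 0 := by linarith
    have hψ' : 1 - ψ * x ≠ 0 := by linarith [(abs_lt.mp hψ).2]
    have hfac : 1 - x - x ^ 2 = (1 - φ * x) * (1 - ψ * x) := by
      linear_combination x * goldenRatio_add_goldenConj - x ^ 2 * goldenRatio_mul_goldenConj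
    rw [hfac, lucas_eq_goldenRatio_pow_add_goldenConj_pow,
      lucas_eq_goldenRatio_pow_add_goldenConj_pow]
    rw [← div_eq_mul_inv, ← div_eq_mul_inv, div_add_div _ _ hφ' hψ']
    congr 1
    have hmul := goldenRatio_mul_goldenConj
    clear h₁ h₂ hφ hψ hφ' hψ' hfac
    generalize φ = p, ψ = q at *
    linear_combination x ^ 3 * (p ^ m + q ^ m) * hmul

theorem hasSum_sub_succ_of_antitone {a : ℕ → ℝ} (ha : Antitone a)
    (h : Filter.Tendsto a Filter.atTop (nhds 0)) : HasSum (fun n ↦ a n - a (n + 1)) (a 0) := by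
  rw [hasSum_iff_tendsto_nat_of_nonneg fun n ↦ sub_nonneg.mpr (ha n.le_succ)]
  simp_rw [Finset.sum_range_sub']
  simpa using h.const_sub (a 0)

theorem hasSum_one_div_add_sub_one_div_add_succ {c : ℝ} (hc : 0 < c) :
    HasSum (fun n : ℕ ↦ 1 / ((n : ℝ) + c) - 1 / ((n : ℝ) + 1 + c)) (1 / c) := by
  have h := hasSum_sub_succ_of_antitone (a := fun n : ℕ ↦ 1 / ((n : ℝ) + c))
    (fun i j hij ↦ by dsimp only; gcongr) (by
      simp_rw [one_div]
      exact (Filter.tendsto_atTop_add_const_right _ c tendsto_natCast_atTop_atTop).inv_tendsto_atTop)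
  simpa using h

theorem hasSum_cotTerm_of_irrational {x : ℝ} (hx : Irrational x) :
    HasSum (fun n : ℕ ↦ 1 / (x - (n + 1)) + 1 / (x + (n + 1))) (π * cot (π * x) - 1 / x) := by
  have hx' : (x : ℂ) ∈ Complex.integerComplement := by
    rintro ⟨n, hn⟩
    exact hx.ne_int n (by exact_mod_cast hn.symm)
  have h := (summable_cotTerm hx').hasSum
  rw [← cot_series_rep' hx'] at h
  refine Complex.hasSum_ofReal.mp ?_
  convert h using 1
  · ext n
    simp [cotTerm]
  · simp

theorem hasSum_one_div_sq_add_sub_one :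
    HasSum (fun n : ℕ ↦ 1 / ((n + 1 : ℝ) ^ 2 + (n + 1 : ℝ) - 1))
      (1 + π / √5 * tan (√5 * π / 2)) := by
  have h := ((hasSum_cotTerm_of_irrational goldenRatio_irrational).add
    (hasSum_one_div_add_sub_one_div_add_succ goldenRatio_pos)).mul_left (-(1 / √5))
  have hcot : cot (π * φ) = -tan (√5 * π / 2) := by
    rw [cot_eq_cos_div_sin, tan_eq_sin_div_cos,
      show π * φ = √5 * π / 2 + π / 2 by rw [goldenRatio]; ring, cos_add_pi_div_two,
      sin_add_pi_div_two, neg_div]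
  have h' : HasSum (fun n : ℕ ↦ 1 / ((n : ℝ) ^ 2 + n - 1)) (π / √5 * tan (√5 * π / 2)) := by
    convert! h using 1
    · ext n
      have h₁ : φ - (n + 1) ≠ 0 := by
        exact_mod_cast sub_ne_zero.mpr (goldenRatio_irrational.ne_nat (n + 1))
      have := goldenRatio_pos
      have h₂ : (n : ℝ) + φ ≠ 0 := by positivity
      have h₄ : (n : ℝ) ^ 2 + n - 1 = -(φ - (n + 1)) * (n + φ) := by
        linear_combination goldenRatio_sq
      have h₅ : √5 = 2 * φ - 1 := by rw [goldenRatio]; ring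
      have h₆ : 2 * φ - 1 ≠ 0 := by linarith [one_lt_goldenRatio]
      rw [h₄, h₅, add_comm φ]
      have hs : 2 * φ - 1 = φ - (n + 1) + (n + φ) := by ring
      rw [add_add_sub_cancel]
      generalize φ - ((n : ℝ) + 1) = u, (n : ℝ) + φ = v, 2 * φ - 1 = s at *
      field_simp
      linear_combination -hs
    · rw [hcot]
      ring
  have h'' := (hasSum_nat_add_iff' 1).mpr h'
  convert! h'' using 1
  · simp
  · simp
    ring

theorem hasSum_one_div_add_two_mul {t : ℝ}
    (ht : HasSum (fun n : ℕ ↦ 1 / ((n + 1 : ℝ) * ((n + 1 : ℝ) ^ 2 + (n + 1 : ℝ) - 1))) t) :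
    HasSum (fun n : ℕ ↦ 1 / ((n + 2 : ℝ) * ((n + 1 : ℝ) ^ 2 + (n + 1 : ℝ) - 1)))
      (t - π / √5 * tan (√5 * π / 2)) := by
  convert! (ht.sub hasSum_one_div_sq_add_sub_one).add
    (hasSum_one_div_add_sub_one_div_add_succ one_pos) using 1
  · ext n
    have h : ((n : ℝ) + 1) ^ 2 + (n + 1) - 1 ≠ 0 := by
      have : (0 : ℝ) ≤ n := n.cast_nonneg
      nlinarith
    rw [show (n : ℝ) + 1 + 1 = n + 2 by ring]
    generalize hq : ((n : ℝ) + 1) ^ 2 + (n + 1) - 1 = q at *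
    field_simp
    linear_combination hq
  · ring

theorem summable_one_div_mul_sq_add_sub_one :
    Summable fun n : ℕ ↦ 1 / ((n + 1 : ℝ) * ((n + 1 : ℝ) ^ 2 + (n + 1 : ℝ) - 1)) := by
  have hq (n : ℕ) : 0 < ((n : ℝ) + 1) ^ 2 + (n + 1) - 1 := by
    have : (0 : ℝ) ≤ n := n.cast_nonneg
    nlinarith
  refine hasSum_one_div_sq_add_sub_one.summable.of_nonneg_of_le
    (fun n ↦ one_div_nonneg.mpr (mul_nonneg (by positivity) (hq n).le)) fun n ↦ ?_
  refine one_div_le_one_div_of_le (hq n) (le_mul_of_one_le_left (hq n).le ?_)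
  linarith [n.cast_nonneg (α := ℝ)]

theorem riemannZeta_sub_one_eq_tsum (k : ℕ) :
    riemannZeta (k + 2) - 1 = ((∑' n : ℕ, (1 / (n + 2 : ℝ)) ^ (k + 2) : ℝ) : ℂ) := by
  have hs : Summable fun n : ℕ ↦ 1 / (n : ℝ) ^ (k + 2) :=
    summable_one_div_nat_pow.mpr (by lia)
  have hz := zeta_nat_eq_tsum_of_gt_one (k := k + 2) (by lia)
  have hsum := hs.sum_add_tsum_nat_add 2
  rw [show (riemannZeta (k + 2) : ℂ) = ((∑' n : ℕ, 1 / (n : ℝ) ^ (k + 2) : ℝ) : ℂ) by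
    push_cast at hz ⊢; exact hz, ← hsum]
  simp [Finset.sum_range_succ]

theorem lucas_succ_eq_add_lucasZ (m : ℕ) :
    (lucas (m + 1) : ℝ) = lucas m + (lucasZ ((m : ℤ) - 1) : ℝ) := by
  cases m with
  | zero => norm_num [lucas, lucasZ]
  | succ m => simp [lucas, lucasZ, add_comm]

theorem tsum_lucas_mul_zeta (m : ℕ) :
    ∑' k : ℕ, (∑' n : ℕ, (1 / (n + 2 : ℝ)) ^ (k + 2)) * (lucas (k + m + 1) : ℝ) =
      (lucas (m + 1) : ℝ)
        + (lucasZ ((m : ℤ) - 1) : ℝ) * (π / √5) * tan (√5 * π / 2)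
        + (lucas m : ℝ) *
          ∑' n : ℕ, 1 / ((n + 1 : ℝ) * ((n + 1 : ℝ) ^ 2 + (n + 1 : ℝ) - 1)) := by
  have hk (n : ℕ) : HasSum (fun k : ℕ ↦ (lucas (k + m + 1) : ℝ) * (1 / (n + 2 : ℝ)) ^ (k + 2))
      (lucas (m + 1) * (1 / ((n + 1 : ℝ) ^ 2 + (n + 1 : ℝ) - 1)) +
        lucas m * (1 / ((n + 2 : ℝ) * ((n + 1 : ℝ) ^ 2 + (n + 1 : ℝ) - 1)))) := by
    convert! hasSum_lucas_mul_pow m (x := 1 / (n + 2 : ℝ)) (by positivity)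
      (one_div_le_one_div_of_le two_pos (by linarith [n.cast_nonneg (α := ℝ)])) using 1
    have h : ((n : ℝ) + 1) ^ 2 + (n + 1) - 1 ≠ 0 := by
      have : (0 : ℝ) ≤ n := n.cast_nonneg
      nlinarith
    have h' : 1 - 1 / ((n : ℝ) + 2) - (1 / ((n : ℝ) + 2)) ^ 2 =
        (((n : ℝ) + 1) ^ 2 + (n + 1) - 1) / (n + 2) ^ 2 := by
      field_simp
      ring
    rw [h']
    field_simp
  have hn := (hasSum_one_div_sq_add_sub_one.mul_left (lucas (m + 1) : ℝ)).add
    ((hasSum_one_div_add_two_mul summable_one_div_mul_sq_add_sub_one.hasSum).mul_left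
      (lucas m : ℝ))
  have hs : Summable (Function.uncurry fun n k : ℕ ↦
      (lucas (k + m + 1) : ℝ) * (1 / (n + 2 : ℝ)) ^ (k + 2)) := by
    rw [summable_prod_of_nonneg fun p ↦ by simp only [Function.uncurry, Pi.zero_apply]; positivity]
    refine ⟨fun n ↦ (hk n).summable, ?_⟩
    simpa only [Function.uncurry, (hk _).tsum_eq] using hn.summable
  simp_rw [mul_comm (∑' n : ℕ, _) (lucas _ : ℝ), ← tsum_mul_left]
  rw [hs.tsum_comm]
  simp_rw [(hk _).tsum_eq]
  rw [hn.tsum_eq, lucas_succ_eq_add_lucasZ, tsum_mul_left]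
  ring

theorem stmt12 (m : ℕ) :
    ∑' k : ℕ, (riemannZeta (k + 2) - 1) * (lucas (k + m + 1) : ℂ) =
      (((lucas (m + 1) : ℝ)
        + (lucasZ ((m : ℤ) - 1) : ℝ) * (π / Real.sqrt 5) * Real.tan (Real.sqrt 5 * π / 2)
        + (lucas m : ℝ) *
          ∑' n : ℕ, 1 / ((n + 1 : ℝ) * ((n + 1 : ℝ) ^ 2 + (n + 1 : ℝ) - 1)) : ℝ) : ℂ) := by
  rw [← tsum_lucas_mul_zeta, Complex.ofReal_tsum]
  simp_rw [riemannZeta_sub_one_eq_tsum, Complex.ofReal_mul, Complex.ofReal_natCast]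
end

section
/- For every integer m ≥ 0, ∑_{k=1}^∞ (ζ(2k) − 1)·L_{2k+m−1}/k = L_{m−1}·ln(−π·sec(√5·π/2)) + 2√5·F_{m−1}·ln α, where α = (1+√5)/2, and where for m = 0 one sets F_{−1} = 1 and L_{−1} = −1 (the standard extensions to negative indices). -/
open Real

theorem hasSum_neg_log_one_sub_sq_div {x : ℝ} (hx : x ^ 2 < 4) (hs : sin (π * x) ≠ 0)
    (h1 : x ^ 2 ≠ 1) :
    HasSum (fun n : ℕ ↦ -log (1 - x ^ 2 / ((n : ℝ) + 2) ^ 2))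
      (log (π * x * (1 - x ^ 2) / sin (π * x))) := by
  have hlt (n : ℕ) : x ^ 2 / ((n : ℝ) + 2) ^ 2 < 1 := by
    rw [div_lt_one (by positivity)]
    nlinarith [(n.cast_nonneg : (0 : ℝ) ≤ n)]
  have hpos (n : ℕ) : 0 < 1 - x ^ 2 / ((n : ℝ) + 2) ^ 2 := sub_pos.2 (hlt n)
  have hnn (n : ℕ) : 0 ≤ -log (1 - x ^ 2 / ((n : ℝ) + 2) ^ 2) := by
    refine neg_nonneg.2 (log_nonpos (hpos n).le ?_)
    have : 0 ≤ x ^ 2 / ((n : ℝ) + 2) ^ 2 := by positivity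
    linarith
  have hx0 : x ≠ 0 := by
    rintro rfl
    simp at hs
  have hc : π * x * (1 - x ^ 2) ≠ 0 :=
    mul_ne_zero (mul_ne_zero pi_ne_zero hx0) (sub_ne_zero.2 h1.symm)
  rw [hasSum_iff_tendsto_nat_of_nonneg hnn]
  have hprod : Filter.Tendsto
      (fun N : ℕ ↦ ∏ n ∈ Finset.range N, (1 - x ^ 2 / ((n : ℝ) + 2) ^ 2)) Filter.atTop
      (nhds (sin (π * x) / (π * x * (1 - x ^ 2)))) := by
    have h := ((Filter.tendsto_add_atTop_iff_nat 1).2 (tendsto_euler_sin_prod x)).div_const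
      (π * x * (1 - x ^ 2))
    refine h.congr fun N ↦ ?_
    rw [Finset.prod_range_succ', div_eq_iff hc]
    have : ∀ n : ℕ, (((n + 1 : ℕ) : ℝ) + 1) = n + 2 := fun n ↦ by push_cast; ring
    simp only [this]
    push_cast
    ring
  have hlog := (hprod.log (div_ne_zero hs hc)).neg
  rw [← log_inv, inv_div] at hlog
  refine hlog.congr fun N ↦ ?_
  rw [log_prod fun n _ ↦ (hpos n).ne', Finset.sum_neg_distrib]

theorem riemannZeta_two_mul_succ_eq_ofReal_tsum (k : ℕ) :
    riemannZeta (2 * (k + 1)) = ((∑' n : ℕ, 1 / (n : ℝ) ^ (2 * (k + 1)) : ℝ) : ℂ) := by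
  have hz := zeta_nat_eq_tsum_of_gt_one (k := 2 * (k + 1)) (by omega)
  push_cast at hz ⊢
  exact hz

theorem hasSum_one_div_add_two_pow (k : ℕ) :
    HasSum (fun n : ℕ ↦ 1 / ((n : ℝ) + 2) ^ (2 * (k + 1)))
      (riemannZeta (2 * (k + 1)) - 1).re := by
  have hsum : Summable fun n : ℕ ↦ 1 / (n : ℝ) ^ (2 * (k + 1)) :=
    Real.summable_one_div_nat_pow.2 (by omega)
  rw [riemannZeta_two_mul_succ_eq_ofReal_tsum, Complex.sub_re, Complex.ofReal_re, Complex.one_re]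
  simpa [Finset.sum_range_succ] using (hasSum_nat_add_iff' 2).2 hsum.hasSum

theorem hasSum_comm_of_nonneg {ι κ : Type*} {f : ι → κ → ℝ} (hf : ∀ i j, 0 ≤ f i j)
    {g : ι → ℝ} {h : κ → ℝ} {a : ℝ} (hg : ∀ i, HasSum (f i) (g i))
    (hh : ∀ j, HasSum (fun i ↦ f i j) (h j)) (ha : HasSum g a) : HasSum h a := by
  have hs : Summable (fun p : ι × κ ↦ f p.1 p.2) := by
    rw [summable_prod_of_nonneg fun p ↦ hf p.1 p.2]
    refine ⟨fun i ↦ (hg i).summable, ?_⟩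
    simpa only [(hg _).tsum_eq] using ha.summable
  obtain ⟨b, hb⟩ := hs
  obtain rfl := (hb.prod_fiberwise hg).unique ha
  exact ((Equiv.prodComm κ ι).hasSum_iff.2 hb).prod_fiberwise hh

theorem hasSum_riemannZeta_sub_one_mul_pow {x : ℝ} (hx : x ^ 2 < 4) (hs : sin (π * x) ≠ 0)
    (h1 : x ^ 2 ≠ 1) :
    HasSum (fun k : ℕ ↦ (riemannZeta (2 * (k + 1)) - 1).re * x ^ (2 * (k + 1)) / (k + 1))
      (log (π * x * (1 - x ^ 2) / sin (π * x))) := by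
  refine hasSum_comm_of_nonneg
    (f := fun n k : ℕ ↦ (x ^ 2 / ((n : ℝ) + 2) ^ 2) ^ (k + 1) / (k + 1))
    (fun n k ↦ by positivity) (fun n ↦ ?_) (fun k ↦ ?_)
    (hasSum_neg_log_one_sub_sq_div hx hs h1)
  · refine hasSum_pow_div_log_of_abs_lt_one ?_
    rw [abs_of_nonneg (by positivity), div_lt_one (by positivity)]
    nlinarith [(n.cast_nonneg : (0 : ℝ) ≤ n)]
  · refine (((hasSum_one_div_add_two_pow k).mul_right (x ^ (2 * (k + 1)))).div_const
      ((k : ℝ) + 1)).congr_fun fun n ↦ ?_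
    rw [div_pow, ← pow_mul, ← pow_mul]
    ring

theorem lucas_eq_goldenRatio_pow_add (n : ℕ) :
    (lucas n : ℝ) = goldenRatio ^ n + goldenConj ^ n := by
  induction n using Nat.twoStepInduction with
  | zero => norm_num [lucas]
  | one => simp [lucas]
  | more n h0 h1 =>
    rw [lucas, Nat.cast_add, h0, h1, pow_add _ n 2, pow_add _ n 2, goldenRatio_sq, goldenConj_sq]
    ring

theorem lucasZ_natCast_sub_one (m : ℕ) :
    (lucasZ ((m : ℤ) - 1) : ℝ) =
      -(goldenRatio ^ m * goldenConj + goldenConj ^ m * goldenRatio) := by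
  cases m with
  | zero =>
    norm_num [lucasZ, lucas]
    linarith [goldenRatio_add_goldenConj]
  | succ n =>
    have : lucasZ (((n + 1 : ℕ) : ℤ) - 1) = lucas n := by simp [lucasZ]
    rw [this, Int.cast_natCast, lucas_eq_goldenRatio_pow_add, pow_succ, pow_succ]
    linear_combination (goldenRatio ^ n + goldenConj ^ n) * goldenRatio_mul_goldenConj

theorem sqrt_five_mul_fibZ_natCast_sub_one (m : ℕ) :
    √5 * (fibZ ((m : ℤ) - 1) : ℝ) =
      -(goldenRatio ^ m * goldenConj - goldenConj ^ m * goldenRatio) := by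
  cases m with
  | zero =>
    norm_num [fibZ]
  | succ n =>
    have : fibZ (((n + 1 : ℕ) : ℤ) - 1) = Nat.fib n := by simp [fibZ]
    rw [this, Int.cast_natCast, coe_fib_eq, mul_div_cancel₀ _ (by positivity), pow_succ, pow_succ]
    linear_combination (goldenRatio ^ n - goldenConj ^ n) * goldenRatio_mul_goldenConj

theorem sin_pi_mul_goldenRatio : sin (π * goldenRatio) = cos (√5 * π / 2) := by
  rw [← sin_add_pi_div_two, goldenRatio]
  ring_nf

theorem sin_pi_mul_goldenConj : sin (π * goldenConj) = cos (√5 * π / 2) := by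
  rw [← sin_pi_div_two_sub, goldenConj]
  ring_nf

theorem cos_sqrt_five_mul_pi_div_two_neg : cos (√5 * π / 2) < 0 := by
  have h2 : 2 < √5 := lt_sqrt_of_sq_lt (by norm_num)
  have h3 : √5 < 3 := (sqrt_lt' (by norm_num)).2 (by norm_num)
  apply cos_neg_of_pi_div_two_lt_of_lt <;> nlinarith [pi_pos]

theorem stmt14 (m : ℕ) :
    ∑' k : ℕ, (riemannZeta (2 * (k + 1)) - 1) * (lucas (2 * k + m + 1) : ℂ) / (k + 1 : ℂ) =
      (((lucasZ ((m : ℤ) - 1) : ℝ) * Real.log (-π / Real.cos (Real.sqrt 5 * π / 2))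
        + 2 * Real.sqrt 5 * (fibZ ((m : ℤ) - 1) : ℝ) *
          Real.log ((1 + Real.sqrt 5) / 2) : ℝ) : ℂ) := by
  have hcos := cos_sqrt_five_mul_pi_div_two_neg
  have hS : -π / cos (√5 * π / 2) ≠ 0 := div_ne_zero (neg_ne_zero.2 pi_ne_zero) hcos.ne
  have hα : HasSum
      (fun k : ℕ ↦ (riemannZeta (2 * (k + 1)) - 1).re * goldenRatio ^ (2 * (k + 1)) / (k + 1))
      (log (-π / cos (√5 * π / 2)) + 2 * log goldenRatio) := by
    convert hasSum_riemannZeta_sub_one_mul_pow (x := goldenRatio) ?_ ?_ ?_ using 1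
    · rw [sin_pi_mul_goldenRatio, goldenRatio_sq, two_mul, ← log_mul goldenRatio_ne_zero
        goldenRatio_ne_zero, ← sq, ← log_mul hS (pow_ne_zero _ goldenRatio_ne_zero)]
      ring_nf
    · rw [goldenRatio_sq]; linarith [goldenRatio_lt_two]
    · rw [sin_pi_mul_goldenRatio]; exact hcos.ne
    · rw [goldenRatio_sq]; linarith [goldenRatio_pos]
  have hβ : HasSum
      (fun k : ℕ ↦ (riemannZeta (2 * (k + 1)) - 1).re * goldenConj ^ (2 * (k + 1)) / (k + 1))
      (log (-π / cos (√5 * π / 2)) - 2 * log goldenRatio) := by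
    convert hasSum_riemannZeta_sub_one_mul_pow (x := goldenConj) ?_ ?_ ?_ using 1
    · have hlog : log goldenConj = -log goldenRatio := by
        rw [← log_inv, inv_goldenRatio, log_neg_eq_log]
      rw [sin_pi_mul_goldenConj, goldenConj_sq, sub_eq_add_neg, ← mul_neg, ← hlog, two_mul,
        ← log_mul goldenConj_ne_zero goldenConj_ne_zero, ← sq, ← log_mul hS (pow_ne_zero _ goldenConj_ne_zero)]
      ring_nf
    · rw [goldenConj_sq]; linarith [goldenConj_neg]
    · rw [sin_pi_mul_goldenConj]; exact hcos.ne
    · rw [goldenConj_sq]; linarith [goldenConj_neg]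
  have key := (hα.mul_left (-(goldenRatio ^ m * goldenConj))).add
    (hβ.mul_left (-(goldenConj ^ m * goldenRatio)))
  refine ((Complex.hasSum_ofReal.2 key).congr_fun fun k ↦ ?_).tsum_eq.trans ?_
  · have hL : (lucas (2 * k + m + 1) : ℝ) =
        -(goldenRatio ^ m * goldenConj) * goldenRatio ^ (2 * (k + 1)) +
          -(goldenConj ^ m * goldenRatio) * goldenConj ^ (2 * (k + 1)) := by
      rw [lucas_eq_goldenRatio_pow_add]
      linear_combination (goldenRatio ^ (2 * k + m + 1) + goldenConj ^ (2 * k + m + 1)) *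
        goldenRatio_mul_goldenConj
    rw [← Complex.ofReal_natCast (lucas _), hL, riemannZeta_two_mul_succ_eq_ofReal_tsum,
      ← Complex.ofReal_one, ← Complex.ofReal_sub, Complex.ofReal_re]
    push_cast
    ring
  · have hα' : (1 + √5) / 2 = goldenRatio := rfl
    rw [hα', mul_assoc 2, sqrt_five_mul_fibZ_natCast_sub_one, lucasZ_natCast_sub_one]
    congr 1
    ring
end
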